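/- Let n ≥ 2 and let q ∈ 𝒫ᵒ_{n+1} be of the form q = q^h − 1, where q^h is a homogeneous polynomial of degree m ≥ 2. Let u be a global solution to the thin obstacle problem (with zero obstacle) in ℝ^{n+1} such that |u(x) + |x_{n+1}|·q(x)| → 0 as |x| → ∞. Then the positivity set {x' ∈ ℝ^n : u(x', 0) > 0} is bounded and star-shaped with respect to the origin. -/

import Mathlib

open MeasureTheory Metric Set Filter

noncomputable section

/-- The point `(x', t)` of `ℝ^{n+1}`, where `x' ∈ ℝ^n`. -/
def thinEmbed (n : ℕ) (x' : EuclideanSpace ℝ (Fin n)) (t : ℝ) :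
    EuclideanSpace ℝ (Fin (n + 1)) :=
  (EuclideanSpace.equiv (Fin (n + 1)) ℝ).symm (Fin.snoc (fun i => x' i) t)

/-- Projection of a point of `ℝ^{n+1}` to its first `n` coordinates. -/
def thinProj (n : ℕ) (x : EuclideanSpace ℝ (Fin (n + 1))) : EuclideanSpace ℝ (Fin n) :=
  (EuclideanSpace.equiv (Fin n) ℝ).symm (fun i => x i.castSucc)

/-- The Laplacian of `f : ℝ^d → ℝ`: the sum of pure second partial derivatives. -/
def lapl (d : ℕ) (f : EuclideanSpace ℝ (Fin d) → ℝ) (x : EuclideanSpace ℝ (Fin d)) : ℝ :=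
  ∑ i : Fin d,
    fderiv ℝ (fun y => fderiv ℝ f y (EuclideanSpace.single i 1)) x (EuclideanSpace.single i 1)

/-- `f` is harmonic on a set: twice continuously differentiable with vanishing Laplacian. -/
def IsHarmonicOnSet (d : ℕ) (f : EuclideanSpace ℝ (Fin d) → ℝ)
    (s : Set (EuclideanSpace ℝ (Fin d))) : Prop :=
  ContDiffOn ℝ 2 f s ∧ ∀ x ∈ s, lapl d f x = 0

/-- Super-mean-value property w.r.t. averages over balls
(encodes `Δf ≤ 0` for continuous `f`). -/
def SuperMeanVal (d : ℕ) (f : EuclideanSpace ℝ (Fin d) → ℝ) : Prop :=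
  ∀ (x : EuclideanSpace ℝ (Fin d)) (r : ℝ), 0 < r → (⨍ y in Metric.ball x r, f y) ≤ f x

/-- The contact set `Λ_φ(u) = {(x',0) : u(x',0) = φ(x')}`. -/
def contactSet (n : ℕ) (φ : EuclideanSpace ℝ (Fin n) → ℝ)
    (u : EuclideanSpace ℝ (Fin (n + 1)) → ℝ) : Set (EuclideanSpace ℝ (Fin (n + 1))) :=
  {x | x (Fin.last n) = 0 ∧ u x = φ (thinProj n x)}

/-- Global solution to the thin obstacle problem in `ℝ^{n+1}` with thin obstacle `φ`:
continuous, even in the last variable, above the obstacle on the thin space,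
harmonic outside the contact set, and superharmonic (mean value inequality). -/
def IsGlobalSolution (n : ℕ) (φ : EuclideanSpace ℝ (Fin n) → ℝ)
    (u : EuclideanSpace ℝ (Fin (n + 1)) → ℝ) : Prop :=
  Continuous u ∧
  (∀ x' t, u (thinEmbed n x' t) = u (thinEmbed n x' (-t))) ∧
  (∀ x', φ x' ≤ u (thinEmbed n x' 0)) ∧
  IsHarmonicOnSet (n + 1) u (contactSet n φ u)ᶜ ∧
  SuperMeanVal (n + 1) u

/-- Evaluation of a real polynomial at a point of `ℝ^d`. -/
def pev {d : ℕ} (q : MvPolynomial (Fin d) ℝ) (x : EuclideanSpace ℝ (Fin d)) : ℝ :=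
  MvPolynomial.eval (fun i => x i) q

/-- Polynomial growth (of some order). -/
def HasPolyGrowth (d : ℕ) (u : EuclideanSpace ℝ (Fin d) → ℝ) : Prop :=
  ∃ (m : ℕ) (C : ℝ), ∀ x, |u x| ≤ C * (1 + ‖x‖ ^ m)

/-- Polynomial growth of order exactly `m` (and `m` is the smallest such order). -/
def PolyGrowthOrder (d : ℕ) (u : EuclideanSpace ℝ (Fin d) → ℝ) (m : ℕ) : Prop :=
  (∃ C : ℝ, ∀ x, |u x| ≤ C * (1 + ‖x‖ ^ m)) ∧
  ∀ m' : ℕ, (∃ C : ℝ, ∀ x, |u x| ≤ C * (1 + ‖x‖ ^ m')) → m ≤ m'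

/-- The class `𝒫ᵒ_{n+1}`: polynomials `q` even in the last variable such that
`x_{n+1} q(x)` is harmonic and `closure {q(·,0) < 0}` is compact. -/
def MemPo (n : ℕ) (q : MvPolynomial (Fin (n + 1)) ℝ) : Prop :=
  (∀ x' t, pev q (thinEmbed n x' t) = pev q (thinEmbed n x' (-t))) ∧
  IsHarmonicOnSet (n + 1) (fun x => x (Fin.last n) * pev q x) Set.univ ∧
  IsCompact (closure {x' : EuclideanSpace ℝ (Fin n) | pev q (thinEmbed n x' 0) < 0})

/-- The class `𝒫ᵉ_{n+1}`: harmonic polynomials `p` even in the last variable such that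
`closure {p(·,0) < 0}` is compact. -/
def MemPe (n : ℕ) (p : MvPolynomial (Fin (n + 1)) ℝ) : Prop :=
  (∀ x' t, pev p (thinEmbed n x' t) = pev p (thinEmbed n x' (-t))) ∧
  IsHarmonicOnSet (n + 1) (pev p) Set.univ ∧
  IsCompact (closure {x' : EuclideanSpace ℝ (Fin n) | pev p (thinEmbed n x' 0) < 0})

/-- `f(x) → 0` as `|x| → ∞`. -/
def VanishAtInfty (d : ℕ) (f : EuclideanSpace ℝ (Fin d) → ℝ) : Prop :=
  ∀ ε > 0, ∃ R : ℝ, ∀ x, R ≤ ‖x‖ → |f x| < ε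

/-- The embedding of a subset of `ℝ^n` into the thin space of `ℝ^{n+1}`. -/
def thinSet (n : ℕ) (S : Set (EuclideanSpace ℝ (Fin n))) :
    Set (EuclideanSpace ℝ (Fin (n + 1))) :=
  (fun x' => thinEmbed n x' 0) '' S

/-- The free boundary `Γ(u)`: the boundary in `ℝ^n` of the positivity set, embedded. -/
def freeBoundary (n : ℕ) (u : EuclideanSpace ℝ (Fin (n + 1)) → ℝ) :
    Set (EuclideanSpace ℝ (Fin (n + 1))) :=
  thinSet n (frontier {x' : EuclideanSpace ℝ (Fin n) | 0 < u (thinEmbed n x' 0)})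

/-- Negating the `i`-th coordinate of a point of `ℝ^d`. -/
def negCoordAt (d : ℕ) (i : Fin d) (x : EuclideanSpace ℝ (Fin d)) :
    EuclideanSpace ℝ (Fin d) :=
  (EuclideanSpace.equiv (Fin d) ℝ).symm (Function.update (fun j => x j) i (-(x i)))

/-- The constant `ρ̄(k, n)`, where `κ = k/(n-1)`. -/
def rhoBar (k n : ℕ) : ℝ :=
  ((k : ℝ) / ((n : ℝ) - 1)) ^ (-(1 : ℝ) / (((n : ℝ) - 1) * ((k : ℝ) / ((n : ℝ) - 1) + 1))) *
    (((k : ℝ) / ((n : ℝ) - 1)) ^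
        (-((k : ℝ) / ((n : ℝ) - 1)) / ((k : ℝ) / ((n : ℝ) - 1) + 1)) +
      ((k : ℝ) / ((n : ℝ) - 1)) ^ ((1 : ℝ) / ((k : ℝ) / ((n : ℝ) - 1) + 1))) ^
      (-(1 : ℝ) / (((n : ℝ) - 1) * ((k : ℝ) / ((n : ℝ) - 1))))

/-- The barrier function `g_{A,t}(r) = A r^{1-n} + t - 1 + r^k`. -/
def gfun (n k : ℕ) (A t r : ℝ) : ℝ :=
  A * r ^ ((1 : ℝ) - (n : ℝ)) + t - 1 + r ^ k

variable {d : ℕ}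

lemma taylor_two {f : EuclideanSpace ℝ (Fin d) → ℝ} {x : EuclideanSpace ℝ (Fin d)}
    (hf : ContDiffAt ℝ 2 f x) {ε : ℝ} (hε : 0 < ε) :
    ∃ δ > 0, ∀ z, ‖z‖ < δ →
      |f (x + z) - f x - fderiv ℝ f x z - 1 / 2 * fderiv ℝ (fderiv ℝ f) x z z| ≤ ε * ‖z‖ ^ 2 := by
  set B := fderiv ℝ (fderiv ℝ f) x with hB
  have hsymm : ∀ v w, B v w = B w v := fun v w =>
    (hf.isSymmSndFDerivAt (by simp)).eq v w
  have hfd : DifferentiableAt ℝ (fderiv ℝ f) x :=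
    (hf.fderiv_right (m := 1) (by norm_num)).differentiableAt (by norm_num)
  have h1 : ∀ᶠ y in nhds x, DifferentiableAt ℝ f y :=
    (hf.eventually (by simp)).mono fun y hy => hy.differentiableAt (by norm_num)
  have h2 := (hasFDerivAt_iff_isLittleO.1 hfd.hasFDerivAt).def hε
  obtain ⟨δ, hδ, h⟩ := Metric.eventually_nhds_iff.1 (h1.and h2)
  refine ⟨δ, hδ, fun z hz => ?_⟩
  let g : EuclideanSpace ℝ (Fin d) → ℝ := fun y => f (x + y) - fderiv ℝ f x y - 1 / 2 * B y y
  have hder : ∀ y ∈ closedBall (0 : EuclideanSpace ℝ (Fin d)) ‖z‖,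
      HasFDerivWithinAt g (fderiv ℝ f (x + y) - fderiv ℝ f x - B y) (closedBall 0 ‖z‖) y := by
    intro y hy
    have hy' : ‖y‖ < δ := lt_of_le_of_lt (by simpa using hy) hz
    have hd := (h (y := x + y) (by simpa using hy')).1
    have e1 : HasFDerivAt (fun y => f (x + y)) (fderiv ℝ f (x + y)) y := by
      simpa [Function.comp_def] using hd.hasFDerivAt.comp y ((hasFDerivAt_id y).const_add x)
    have e2 : HasFDerivAt (fun y => fderiv ℝ f x y) (fderiv ℝ f x) y :=
      (fderiv ℝ f x).hasFDerivAt
    have e3 := (B.hasFDerivAt (x := y)).clm_apply (hasFDerivAt_id y)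
    refine (((e1.sub e2).sub (e3.const_mul (1 / 2))).congr_fderiv ?_).hasFDerivWithinAt
    ext w
    simp [hsymm w y]
    ring
  have hbd : ∀ y ∈ closedBall (0 : EuclideanSpace ℝ (Fin d)) ‖z‖,
      ‖fderiv ℝ f (x + y) - fderiv ℝ f x - B y‖ ≤ ε * ‖z‖ := by
    intro y hy
    have hy1 : ‖y‖ ≤ ‖z‖ := by simpa using hy
    have := (h (y := x + y) (by simpa using lt_of_le_of_lt hy1 hz)).2
    simp only [add_sub_cancel_left] at this
    exact this.trans (by gcongr)
  have := (convex_closedBall (0 : EuclideanSpace ℝ (Fin d)) ‖z‖).norm_image_sub_le_of_norm_hasFDerivWithin_le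
    hder hbd (x := 0) (y := z) (by simp) (by simp)
  simp only [g, Real.norm_eq_abs] at this
  simp at this
  calc _ = _ := by congr 1; ring
    _ ≤ _ := this
    _ = _ := by ring

lemma setIntegral_ball_comp_isometry (T : EuclideanSpace ℝ (Fin d) ≃ₗᵢ[ℝ] EuclideanSpace ℝ (Fin d))
    (f : EuclideanSpace ℝ (Fin d) → ℝ) (r : ℝ) :
    ∫ z in ball 0 r, f (T z) = ∫ z in ball 0 r, f z := by
  have := T.measurePreserving.setIntegral_preimage_emb
    T.toHomeomorph.measurableEmbedding f (ball 0 r)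
  rw [← this, T.preimage_ball, map_zero]

lemma setIntegral_ball_linear (L : EuclideanSpace ℝ (Fin d) →L[ℝ] ℝ) (r : ℝ) :
    ∫ z in ball 0 r, L z = 0 := by
  have := setIntegral_ball_comp_isometry (LinearIsometryEquiv.neg ℝ) (fun z => L z) r
  simp [integral_neg] at this
  linarith

lemma setIntegral_ball_mul {i j : Fin d} (hij : i ≠ j) (r : ℝ) :
    ∫ z in ball (0 : EuclideanSpace ℝ (Fin d)) r, z i * z j = 0 := by
  have := setIntegral_ball_comp_isometry (LinearIsometryEquiv.piLpCongrRight 2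
    (fun k : Fin d => if k = i then LinearIsometryEquiv.neg ℝ (E := ℝ)
      else LinearIsometryEquiv.refl ℝ ℝ)) (fun z => z i * z j) r
  simp [hij.symm, integral_neg] at this
  linarith

lemma setIntegral_ball_sq (i j : Fin d) (r : ℝ) :
    ∫ z in ball (0 : EuclideanSpace ℝ (Fin d)) r, z i * z i =
      ∫ z in ball (0 : EuclideanSpace ℝ (Fin d)) r, z j * z j := by
  have := setIntegral_ball_comp_isometry (LinearIsometryEquiv.piLpCongrLeft 2 ℝ ℝ
    (Equiv.swap i j)) (fun z => z i * z i) r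
  simpa [LinearIsometryEquiv.piLpCongrLeft_apply, Equiv.piCongrLeft'] using this.symm

lemma integrableOn_ball {f : EuclideanSpace ℝ (Fin d) → ℝ} (hf : Continuous f)
    (x : EuclideanSpace ℝ (Fin d)) (r : ℝ) : IntegrableOn f (ball x r) :=
  (hf.continuousOn.integrableOn_compact (isCompact_closedBall x r)).mono_set ball_subset_closedBall

lemma setIntegral_ball_norm_sq (i : Fin d) (r : ℝ) :
    ∫ z in ball (0 : EuclideanSpace ℝ (Fin d)) r, ‖z‖ ^ 2 =
      d * ∫ z in ball (0 : EuclideanSpace ℝ (Fin d)) r, z i * z i := by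
  simp_rw [EuclideanSpace.real_norm_sq_eq, pow_two]
  rw [integral_finsetSum _ fun j _ => integrableOn_ball (by fun_prop) 0 r]
  rw [Finset.sum_congr rfl fun j _ => setIntegral_ball_sq j i r]
  simp

lemma setIntegral_ball_quadratic (i : Fin d)
    (B : EuclideanSpace ℝ (Fin d) →L[ℝ] EuclideanSpace ℝ (Fin d) →L[ℝ] ℝ) (r : ℝ) :
    ∫ z in ball (0 : EuclideanSpace ℝ (Fin d)) r, B z z =
      (∑ k, B (EuclideanSpace.single k 1) (EuclideanSpace.single k 1)) *
        ∫ z in ball (0 : EuclideanSpace ℝ (Fin d)) r, z i * z i := by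
  have hexp : ∀ z : EuclideanSpace ℝ (Fin d), B z z = ∑ k, ∑ l, z k * z l *
      B (EuclideanSpace.single k 1) (EuclideanSpace.single l 1) := by
    intro z
    have hz : z = ∑ k, z k • EuclideanSpace.single k (1 : ℝ) := by
      ext j; simp [Pi.single_apply]
    conv_lhs => rw [hz]
    simp [Finset.mul_sum, mul_assoc]
    rw [Finset.sum_comm]
    refine Finset.sum_congr rfl fun k _ => Finset.sum_congr rfl fun l _ => ?_
    ring
  rw [integral_congr_ae (.of_forall hexp),
    integral_finsetSum _ fun k _ => integrableOn_ball (by fun_prop) 0 r, Finset.sum_mul]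
  refine Finset.sum_congr rfl fun k _ => ?_
  rw [integral_finsetSum _ fun l _ => integrableOn_ball (by fun_prop) 0 r,
    Finset.sum_eq_single k]
  · rw [integral_mul_const, setIntegral_ball_sq k i r, mul_comm]
  · intro l _ hl
    rw [integral_mul_const, setIntegral_ball_mul hl.symm, zero_mul]
  · simp

lemma lapl_eq {f : EuclideanSpace ℝ (Fin d) → ℝ} {x : EuclideanSpace ℝ (Fin d)}
    (hf : ContDiffAt ℝ 2 f x) :
    lapl d f x = ∑ k, fderiv ℝ (fderiv ℝ f) x (EuclideanSpace.single k 1)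
      (EuclideanSpace.single k 1) := by
  have hfd : DifferentiableAt ℝ (fderiv ℝ f) x :=
    (hf.fderiv_right (m := 1) (by norm_num)).differentiableAt (by norm_num)
  unfold lapl
  refine Finset.sum_congr rfl fun k _ => ?_
  rw [fderiv_clm_apply hfd (differentiableAt_const _)]
  simp

/-- A superharmonic function cannot touch from above, at `x`, a function that is `C²` at `x` with
positive Laplacian there. -/
lemma exists_gt_of_lapl_pos {h s : EuclideanSpace ℝ (Fin d) → ℝ} {x : EuclideanSpace ℝ (Fin d)}
    (hs : Continuous s) (hsm : SuperMeanVal d s) (hh : ContDiffAt ℝ 2 h x)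
    (hpos : 0 < lapl d h x) : ∃ᶠ y in nhds x, s y - s x < h y - h x := by
  rw [lapl_eq hh] at hpos
  set B := fderiv ℝ (fderiv ℝ h) x
  set σ := ∑ k, B (EuclideanSpace.single k 1) (EuclideanSpace.single k 1) with hσ
  obtain ⟨i⟩ : Nonempty (Fin d) := by
    by_contra hne
    rw [not_nonempty_iff] at hne
    simp [hσ] at hpos
  have hd : (0 : ℝ) < d := by exact_mod_cast i.pos
  intro hcon
  simp only [not_lt] at hcon
  obtain ⟨δ, hδ, hT⟩ := taylor_two hh (ε := σ / (4 * d)) (by positivity)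
  obtain ⟨ρ, hρ, hle⟩ := Metric.eventually_nhds_iff.1 hcon
  set r := min δ ρ with hr
  have hr0 : 0 < r := lt_min hδ hρ
  have hlow : ∀ z ∈ ball (0 : EuclideanSpace ℝ (Fin d)) r,
      fderiv ℝ h x z + 1 / 2 * B z z - σ / (4 * d) * ‖z‖ ^ 2 ≤ s (x + z) - s x := by
    intro z hz
    rw [mem_ball_zero_iff] at hz
    have h1 := (abs_le.1 (hT z (hz.trans_le (min_le_left _ _)))).1
    have h2 := hle (y := x + z) (by simpa using hz.trans_le (min_le_right _ _))
    linarith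
  have hI : ∫ z in ball (0 : EuclideanSpace ℝ (Fin d)) r,
      (fderiv ℝ h x z + 1 / 2 * B z z - σ / (4 * d) * ‖z‖ ^ 2) ≤
      ∫ z in ball (0 : EuclideanSpace ℝ (Fin d)) r, (s (x + z) - s x) :=
    setIntegral_mono_on (integrableOn_ball (by fun_prop) 0 r) (integrableOn_ball (by fun_prop) 0 r)
      measurableSet_ball hlow
  rw [integral_sub (integrableOn_ball (by fun_prop) 0 r) (integrableOn_ball (by fun_prop) 0 r),
    integral_add (integrableOn_ball (by fun_prop) 0 r) (integrableOn_ball (by fun_prop) 0 r),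
    integral_const_mul, integral_const_mul, setIntegral_ball_linear, setIntegral_ball_quadratic i,
    setIntegral_ball_norm_sq i, ← hσ] at hI
  have hvol : 0 < volume.real (ball (0 : EuclideanSpace ℝ (Fin d)) r) :=
    ENNReal.toReal_pos (measure_ball_pos _ _ hr0).ne' measure_ball_lt_top.ne
  have hS : ∫ z in ball (0 : EuclideanSpace ℝ (Fin d)) r, (s (x + z) - s x) ≤ 0 := by
    have htr : ∫ z in ball (0 : EuclideanSpace ℝ (Fin d)) r, s (x + z) = ∫ y in ball x r, s y := by
      have := (measurePreserving_add_left volume x).setIntegral_preimage_emb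
        (Homeomorph.addLeft x).measurableEmbedding s (ball x r)
      rw [← this]
      congr 2
      ext z
      simp
    have hx := hsm x r hr0
    rw [setAverage_eq, smul_eq_mul] at hx
    have hv : volume.real (ball x r) = volume.real (ball (0 : EuclideanSpace ℝ (Fin d)) r) := by
      simp only [Measure.real, Measure.addHaar_ball_center]
    rw [hv, inv_mul_le_iff₀ hvol] at hx
    rw [integral_sub (integrableOn_ball (by fun_prop) 0 r) (integrableOn_ball (by fun_prop) 0 r),
      htr, setIntegral_const, smul_eq_mul]
    linarith
  have hM : 0 < ∫ z in ball (0 : EuclideanSpace ℝ (Fin d)) r, z i * z i := by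
    have h0 : 0 < ∫ z in ball (0 : EuclideanSpace ℝ (Fin d)) r, ‖z‖ ^ 2 := by
      rw [setIntegral_pos_iff_support_of_nonneg_ae (.of_forall fun z => by positivity)
        (integrableOn_ball (by fun_prop) 0 r)]
      let w : EuclideanSpace ℝ (Fin d) := EuclideanSpace.single i (r / 2)
      have hw : ‖w‖ = r / 2 := by simp [w, abs_of_pos hr0]
      refine IsOpen.measure_pos _ (IsOpen.inter ?_ isOpen_ball) ⟨w, ?_, ?_⟩
      · exact Continuous.isOpen_support (by fun_prop)
      · simp only [Function.mem_support, hw]; positivity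
      · rw [mem_ball_zero_iff, hw]; linarith
    rw [setIntegral_ball_norm_sq i] at h0
    exact pos_of_mul_pos_right h0 hd.le
  set M := ∫ z in ball (0 : EuclideanSpace ℝ (Fin d)) r, z i * z i
  have e : σ / (4 * d) * (d * M) = σ * M / 4 := by field_simp
  have := mul_pos hpos hM
  linarith

lemma lapl_add {f g : EuclideanSpace ℝ (Fin d) → ℝ} {x : EuclideanSpace ℝ (Fin d)}
    (hf : ContDiffAt ℝ 2 f x) (hg : ContDiffAt ℝ 2 g x) :
    lapl d (fun y => f y + g y) x = lapl d f x + lapl d g x := by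
  have hd : ∀ {f : EuclideanSpace ℝ (Fin d) → ℝ}, ContDiffAt ℝ 2 f x →
      DifferentiableAt ℝ (fderiv ℝ f) x := fun hf =>
    (hf.fderiv_right (m := 1) (by norm_num)).differentiableAt (by norm_num)
  have h : fderiv ℝ (fun y => f y + g y) =ᶠ[nhds x] fderiv ℝ f + fderiv ℝ g := by
    filter_upwards [hf.eventually (by simp), hg.eventually (by simp)] with y h1 h2
    exact fderiv_fun_add (h1.differentiableAt (by norm_num)) (h2.differentiableAt (by norm_num))
  rw [lapl_eq (hf.add hg), lapl_eq hf, lapl_eq hg, h.fderiv_eq, fderiv_add (hd hf) (hd hg)]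
  simp [Finset.sum_add_distrib]

lemma fderiv_const_mul_apply (c : ℝ) (g : EuclideanSpace ℝ (Fin d) → ℝ)
    (y v : EuclideanSpace ℝ (Fin d)) :
    fderiv ℝ (fun y => c * g y) y v = c * fderiv ℝ g y v := by
  have := congrFun (fderiv_const_smul_field (𝕜 := ℝ) (f := g) c) y
  change fderiv ℝ (c • g) y v = _
  rw [this]; simp

lemma lapl_const_mul (c : ℝ) (f : EuclideanSpace ℝ (Fin d) → ℝ) (x : EuclideanSpace ℝ (Fin d)) :
    lapl d (fun y => c * f y) x = c * lapl d f x := by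
  simp only [lapl, fderiv_const_mul_apply, Finset.mul_sum]

lemma lapl_comp_smul (c : ℝ) (f : EuclideanSpace ℝ (Fin d) → ℝ) (x : EuclideanSpace ℝ (Fin d)) :
    lapl d (fun y => f (c • y)) x = c ^ 2 * lapl d f (c • x) := by
  have h : ∀ (g : EuclideanSpace ℝ (Fin d) → ℝ) y v,
      fderiv ℝ (fun y => g (c • y)) y v = c * fderiv ℝ g (c • y) v := fun g y v => by
    rw [fderiv_comp_smul]; simp
  simp only [lapl, h, Finset.mul_sum]
  refine Finset.sum_congr rfl fun k _ => ?_
  rw [fderiv_const_mul_apply c (fun y => fderiv ℝ f (c • y) (EuclideanSpace.single k 1)),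
    h (fun y => fderiv ℝ f y (EuclideanSpace.single k 1))]
  ring

lemma lapl_coord_sub_sq (j : Fin d) (a : ℝ) (x : EuclideanSpace ℝ (Fin d)) :
    lapl d (fun y => (y j - a) ^ 2) x = 2 := by
  have h1 : ∀ y : EuclideanSpace ℝ (Fin d), HasFDerivAt (fun y : EuclideanSpace ℝ (Fin d) => y j)
      (EuclideanSpace.proj (𝕜 := ℝ) j) y := fun y => (EuclideanSpace.proj (𝕜 := ℝ) j).hasFDerivAt
  have h2 : ∀ y v, fderiv ℝ (fun y : EuclideanSpace ℝ (Fin d) => (y j - a) ^ 2) y v =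
      2 * (y j - a) * v j := fun y v => by
    rw [(((h1 y).sub_const a).pow 2).fderiv]; simp
  have h3 : ∀ k, HasFDerivAt (fun y : EuclideanSpace ℝ (Fin d) => 2 * (y j - a) *
      (EuclideanSpace.single k (1 : ℝ) : EuclideanSpace ℝ (Fin d)) j) _ x := fun k =>
    (((h1 x).sub_const a).const_mul 2).mul_const _
  simp only [lapl, h2, (h3 _).fderiv]
  rw [Finset.sum_eq_single j]
  · simp
  · intro k _ hk
    simp [hk.symm]
  · simp

lemma lapl_sum {ι : Type*} (t : Finset ι) {f : ι → EuclideanSpace ℝ (Fin d) → ℝ}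
    {x : EuclideanSpace ℝ (Fin d)} (hf : ∀ j, ContDiffAt ℝ 2 (f j) x) :
    lapl d (fun y => ∑ j ∈ t, f j y) x = ∑ j ∈ t, lapl d (f j) x := by
  classical
  induction t using Finset.induction_on with
  | empty => simp [lapl]
  | insert j t hj ih =>
    simp only [Finset.sum_insert hj]
    rw [lapl_add (hf j) (ContDiffAt.sum fun k _ => hf k), ih]

lemma contDiff_norm_sub_sq (a : EuclideanSpace ℝ (Fin d)) :
    ContDiff ℝ 2 (fun y : EuclideanSpace ℝ (Fin d) => ‖y - a‖ ^ 2) :=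
  (contDiff_id.sub contDiff_const).norm_sq ℝ

lemma lapl_norm_sub_sq (a x : EuclideanSpace ℝ (Fin d)) :
    lapl d (fun y => ‖y - a‖ ^ 2) x = 2 * d := by
  simp_rw [EuclideanSpace.real_norm_sq_eq, PiLp.sub_apply]
  rw [lapl_sum _ fun j => ContDiff.contDiffAt (by fun_prop)]
  simp [lapl_coord_sub_sq, mul_comm]

/-- Maximum principle for the difference of a subharmonic `C²` function and a superharmonic
function. -/
lemma sub_le_of_superMeanVal [NeZero d] {h s : EuclideanSpace ℝ (Fin d) → ℝ}
    {K V : Set (EuclideanSpace ℝ (Fin d))} (hK : IsCompact K) (hV : IsOpen V) (hVK : V ⊆ K)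
    (hs : Continuous s) (hsm : SuperMeanVal d s) (hhc : ContinuousOn h K)
    (hh : ∀ x ∈ V, ContDiffAt ℝ 2 h x) (hl : ∀ x ∈ V, 0 ≤ lapl d h x) {M : ℝ}
    (hM : ∀ x ∈ K \ V, h x - s x ≤ M) : ∀ x ∈ K, h x - s x ≤ M := by
  intro p hp
  by_contra! hlt
  obtain ⟨R, hR⟩ := hK.isBounded.exists_norm_le
  set η := h p - s p - M
  have hη : 0 < η := by simp only [η]; linarith
  set δ := η / (R ^ 2 + 1) / 2 with hδ
  have hδ0 : 0 < δ := by positivity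
  have hδR : δ * R ^ 2 < η := by
    rw [hδ, div_div, div_mul_eq_mul_div, div_lt_iff₀ (by positivity)]
    nlinarith [sq_nonneg R]
  obtain ⟨x, hxK, hx⟩ := hK.exists_isMaxOn ⟨p, hp⟩
    (f := fun y => h y - s y + δ * ‖y - 0‖ ^ 2)
    ((hhc.sub hs.continuousOn).add (by fun_prop))
  have hxp := hx hp
  simp only [mem_ofPred_eq, sub_zero] at hxp
  have hxV : x ∈ V := by
    by_contra hxV
    have h1 := hM x ⟨hxK, hxV⟩
    have h2 : ‖x‖ ^ 2 ≤ R ^ 2 := by gcongr; exact hR x hxK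
    have h3 : 0 ≤ δ * ‖p‖ ^ 2 := by positivity
    have h4 : δ * ‖x‖ ^ 2 ≤ δ * R ^ 2 := by gcongr
    simp only [η] at hδR
    linarith
  have hc : ContDiffAt ℝ 2 (fun y : EuclideanSpace ℝ (Fin d) => δ * ‖y - 0‖ ^ 2) x :=
    (contDiff_const.mul (contDiff_norm_sub_sq 0)).contDiffAt
  have hpos : 0 < lapl d (fun y => h y + δ * ‖y - 0‖ ^ 2) x := by
    rw [lapl_add (hh x hxV) hc, lapl_const_mul, lapl_norm_sub_sq]
    have : (0 : ℝ) < d := by exact_mod_cast NeZero.pos d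
    have := hl x hxV
    positivity
  obtain ⟨y, hy, hyV⟩ := ((exists_gt_of_lapl_pos hs hsm ((hh x hxV).add hc) hpos).and_eventually
    (hV.mem_nhds hxV)).exists
  have := hx (hVK hyV)
  simp only [mem_ofPred_eq] at this
  linarith

section ThinSpace

variable {n m : ℕ}

@[simp] lemma thinEmbed_last (x' : EuclideanSpace ℝ (Fin n)) (t : ℝ) :
    thinEmbed n x' t (Fin.last n) = t := by simp [thinEmbed]

@[simp] lemma thinEmbed_castSucc (x' : EuclideanSpace ℝ (Fin n)) (t : ℝ) (i : Fin n) :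
    thinEmbed n x' t i.castSucc = x' i := by simp [thinEmbed]

lemma thinEmbed_thinProj (x : EuclideanSpace ℝ (Fin (n + 1))) :
    thinEmbed n (thinProj n x) (x (Fin.last n)) = x := by
  ext i
  refine Fin.lastCases ?_ (fun i => ?_) i
  · simp
  · simp [thinProj]

lemma smul_thinEmbed (c : ℝ) (x' : EuclideanSpace ℝ (Fin n)) (t : ℝ) :
    c • thinEmbed n x' t = thinEmbed n (c • x') (c * t) := by
  ext i
  refine Fin.lastCases ?_ (fun i => ?_) i <;> simp

lemma norm_thinEmbed_zero (x' : EuclideanSpace ℝ (Fin n)) : ‖thinEmbed n x' 0‖ = ‖x'‖ := by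
  simp [EuclideanSpace.norm_eq, Fin.sum_univ_castSucc]

lemma abs_last_le_norm (x : EuclideanSpace ℝ (Fin (n + 1))) : |x (Fin.last n)| ≤ ‖x‖ :=
  PiLp.norm_apply_le x (Fin.last n)

lemma contDiff_pev (q : MvPolynomial (Fin d) ℝ) : ContDiff ℝ 2 (pev q) := by
  unfold pev
  induction q using MvPolynomial.induction_on with
  | C a => simpa using contDiff_const
  | add p q hp hq => simpa using hp.add hq
  | mul_X p i hp => simpa using hp.mul (by fun_prop)

lemma pev_smul {qh : MvPolynomial (Fin d) ℝ} (h : qh.IsHomogeneous m) (c : ℝ)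
    (x : EuclideanSpace ℝ (Fin d)) : pev qh (c • x) = c ^ m * pev qh x := by
  simp only [pev, MvPolynomial.eval_eq, Finset.mul_sum, PiLp.smul_apply, smul_eq_mul, mul_pow,
    Finset.prod_mul_distrib]
  refine Finset.sum_congr rfl fun s hs => ?_
  have hdeg : ∑ i ∈ s.support, s i = m := by
    simpa [Finsupp.weight_apply, Finsupp.sum] using h (MvPolynomial.mem_support_iff.1 hs)
  rw [Finset.prod_pow_eq_pow_sum, hdeg]
  ring

lemma pev_sub_one (qh : MvPolynomial (Fin d) ℝ) (x : EuclideanSpace ℝ (Fin d)) :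
    pev (qh - 1) x = pev qh x - 1 := by simp [pev]

lemma pev_zero_of_homogeneous {qh : MvPolynomial (Fin d) ℝ} (h : qh.IsHomogeneous m)
    (hm : m ≠ 0) : pev qh 0 = 0 := by
  have := pev_smul h 0 0
  simpa [hm] using this

lemma pev_thin_pos {qh : MvPolynomial (Fin (n + 1)) ℝ} (h : qh.IsHomogeneous m)
    (hc : IsCompact (closure {x' : EuclideanSpace ℝ (Fin n) |
      pev (qh - 1) (thinEmbed n x' 0) < 0}))
    {x' : EuclideanSpace ℝ (Fin n)} (hx : x' ≠ 0) : 0 < pev qh (thinEmbed n x' 0) := by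
  by_contra! hle
  obtain ⟨R, hR⟩ := (hc.isBounded.subset subset_closure).exists_norm_le
  have hx0 : 0 < ‖x'‖ := norm_pos_iff.2 hx
  set c := (|R| + 1) / ‖x'‖
  have hc0 : 0 < c := by positivity
  have hmem : c • x' ∈ {x' : EuclideanSpace ℝ (Fin n) |
      pev (qh - 1) (thinEmbed n x' 0) < 0} := by
    have : thinEmbed n (c • x') 0 = c • thinEmbed n x' 0 := by simp [smul_thinEmbed]
    simp only [mem_ofPred_eq, this, pev_sub_one, pev_smul h]
    have := mul_nonpos_of_nonneg_of_nonpos (pow_pos hc0 m).le hle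
    linarith
  have := hR _ hmem
  rw [norm_smul, Real.norm_of_nonneg hc0.le, div_mul_cancel₀ _ hx0.ne'] at this
  linarith [le_abs_self R]

lemma exists_le_pev_near_thin {qh : MvPolynomial (Fin (n + 1)) ℝ} (h : qh.IsHomogeneous m)
    (hm : m ≠ 0) (hc : IsCompact (closure {x' : EuclideanSpace ℝ (Fin n) |
      pev (qh - 1) (thinEmbed n x' 0) < 0})) :
    ∃ R, ∀ x : EuclideanSpace ℝ (Fin (n + 1)), R ≤ ‖x‖ → |x (Fin.last n)| ≤ 1 →
      1 ≤ pev (qh - 1) x := by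
  obtain ⟨c, hc0, hcS⟩ : ∃ c > 0, ∀ x ∈ sphere (0 : EuclideanSpace ℝ (Fin (n + 1))) 1,
      c ≤ max (pev qh x) |x (Fin.last n)| := by
    have hcont : Continuous fun x : EuclideanSpace ℝ (Fin (n + 1)) =>
        max (pev qh x) |x (Fin.last n)| := (contDiff_pev qh).continuous.max (by fun_prop)
    obtain ⟨x, hx, hmin⟩ := (isCompact_sphere (0 : EuclideanSpace ℝ (Fin (n + 1))) 1).exists_isMinOn
      (NormedSpace.sphere_nonempty.2 zero_le_one) hcont.continuousOn
    refine ⟨_, ?_, fun y hy => hmin hy⟩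
    by_cases ht : x (Fin.last n) = 0
    · refine lt_max_of_lt_left ?_
      have hxe := thinEmbed_thinProj x
      rw [ht] at hxe
      rw [← hxe]
      refine pev_thin_pos h hc fun h0 => ?_
      rw [mem_sphere_zero_iff_norm, ← hxe, norm_thinEmbed_zero, h0] at hx
      simp at hx
    · exact lt_max_of_lt_right (abs_pos.2 ht)
  refine ⟨2 / c + 1, fun x hx ht => ?_⟩
  have h2c : 0 < 2 / c := by positivity
  have hx1 : 1 ≤ ‖x‖ := by linarith
  have hx0 : 0 < ‖x‖ := by linarith
  have hcx : 2 ≤ c * ‖x‖ := by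
    have : 2 / c ≤ ‖x‖ := by linarith
    rwa [div_le_iff₀' hc0] at this
  have hunit : ‖x‖⁻¹ • x ∈ sphere (0 : EuclideanSpace ℝ (Fin (n + 1))) 1 := by
    simp [norm_smul, hx0.ne']
  have hlow := hcS _ hunit
  rw [le_max_iff] at hlow
  rcases hlow with hlow | hlow
  · rw [pev_smul h, inv_pow, ← div_eq_inv_mul, le_div_iff₀ (by positivity)] at hlow
    have : ‖x‖ ≤ ‖x‖ ^ m := le_self_pow₀ hx1 hm
    rw [pev_sub_one]
    nlinarith
  · exfalso
    simp only [PiLp.smul_apply, smul_eq_mul, abs_mul, abs_inv, abs_norm] at hlow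
    rw [← div_eq_inv_mul, le_div_iff₀ hx0] at hlow
    linarith

variable {u : EuclideanSpace ℝ (Fin (n + 1)) → ℝ}

lemma IsGlobalSolution.contactSet_isClosed (hu : IsGlobalSolution n (fun _ => 0) u) :
    IsClosed (contactSet n (fun _ => 0) u) :=
  (isClosed_eq (by fun_prop) continuous_const).inter (isClosed_eq hu.1 continuous_const)

lemma IsGlobalSolution.contDiffAt (hu : IsGlobalSolution n (fun _ => 0) u)
    {x : EuclideanSpace ℝ (Fin (n + 1))} (hx : x ∉ contactSet n (fun _ => 0) u) :
    ContDiffAt ℝ 2 u x :=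
  hu.2.2.2.1.1.contDiffAt (hu.contactSet_isClosed.isOpen_compl.mem_nhds hx)

lemma IsGlobalSolution.nonneg (hu : IsGlobalSolution n (fun _ => 0) u)
    {x : EuclideanSpace ℝ (Fin (n + 1))} (hx : x (Fin.last n) = 0) : 0 ≤ u x := by
  have : 0 ≤ u (thinEmbed n (thinProj n x) 0) := hu.2.2.1 (thinProj n x)
  have hxe := thinEmbed_thinProj x
  rw [hx] at hxe
  rwa [hxe] at this

lemma superMeanVal_zero (d : ℕ) : SuperMeanVal d fun _ => 0 := fun _ _ _ => by simp

lemma IsGlobalSolution.isBounded_positivitySet {q : MvPolynomial (Fin (n + 1)) ℝ}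
    (hu : IsGlobalSolution n (fun _ => 0) u)
    (hq : ∃ R, ∀ x : EuclideanSpace ℝ (Fin (n + 1)), R ≤ ‖x‖ → |x (Fin.last n)| ≤ 1 →
      1 ≤ pev q x)
    (hdecay : VanishAtInfty (n + 1) (fun x => u x + |x (Fin.last n)| * pev q x)) :
    Bornology.IsBounded {x' : EuclideanSpace ℝ (Fin n) | 0 < u (thinEmbed n x' 0)} := by
  obtain ⟨R₀, hR₀⟩ := hq
  obtain ⟨R₁, hR₁⟩ := hdecay (1 / (n + 1)) (by positivity)
  refine (isBounded_closedBall (x := (0 : EuclideanSpace ℝ (Fin n)))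
    (r := max R₀ R₁ + 1)).subset fun x' hx' => ?_
  rw [mem_closedBall_zero_iff]
  by_contra! hfar
  simp only [mem_ofPred_eq] at hx'
  set x₀ := thinEmbed n x' 0 with hx₀
  rw [← norm_thinEmbed_zero, ← hx₀] at hfar
  set ε : ℝ := 1 / (n + 1) with hε
  have hε0 : 0 < ε := by positivity
  have hεn : ε * (n + 1) = 1 := by rw [hε]; field_simp
  have hp : ContDiff ℝ 2 fun x : EuclideanSpace ℝ (Fin (n + 1)) =>
      -ε * ‖x - x₀‖ ^ 2 + (x (Fin.last n) - 0) ^ 2 :=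
    (contDiff_const.mul (contDiff_norm_sub_sq x₀)).add (by fun_prop)
  have key := sub_le_of_superMeanVal (isCompact_closedBall x₀ 1)
    (V := ball x₀ 1 \ contactSet n (fun _ => 0) u)
    (h := fun x => u x + (-ε * ‖x - x₀‖ ^ 2 + (x (Fin.last n) - 0) ^ 2)) (M := 0)
    (isOpen_ball.sdiff hu.contactSet_isClosed) (sdiff_subset.trans ball_subset_closedBall)
    continuous_const (superMeanVal_zero _) (hu.1.add hp.continuous).continuousOn
    (fun x hx => (hu.contDiffAt hx.2).add hp.contDiffAt) ?_ ?_ x₀ (by simp)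
  · simp [hx₀] at key
    linarith
  · rintro x ⟨-, hx⟩
    rw [lapl_add (hu.contDiffAt hx) hp.contDiffAt,
      lapl_add (contDiff_const.mul (contDiff_norm_sub_sq x₀)).contDiffAt
        (ContDiff.contDiffAt (by fun_prop)), lapl_const_mul, lapl_norm_sub_sq, lapl_coord_sub_sq,
      hu.2.2.2.1.2 x hx]
    push_cast
    linarith
  · rintro x ⟨hx1, hx2⟩
    rw [mem_closedBall, dist_eq_norm] at hx1
    by_cases hxc : x ∈ contactSet n (fun _ => 0) u
    · have h1 : x (Fin.last n) = 0 := hxc.1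
      have h2 : u x = 0 := hxc.2
      simp only [h1, h2]
      have : 0 ≤ ε * ‖x - x₀‖ ^ 2 := by positivity
      linarith
    · have hx3 : ‖x - x₀‖ = 1 := by
        refine le_antisymm hx1 (not_lt.1 fun hlt => hx2 ⟨?_, hxc⟩)
        rwa [mem_ball, dist_eq_norm]
      have ht : |x (Fin.last n)| ≤ 1 := by
        have := abs_last_le_norm (x - x₀)
        rw [hx3] at this
        simpa [hx₀] using this
      have hxn : max R₀ R₁ ≤ ‖x‖ := by
        have : ‖x₀‖ ≤ ‖x‖ + ‖x - x₀‖ := by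
          rw [norm_sub_rev]; simpa using norm_add_le x (x₀ - x)
        linarith
      have hqx := hR₀ x ((le_max_left _ _).trans hxn) ht
      have hux := (abs_lt.1 (hR₁ x ((le_max_right _ _).trans hxn))).2
      have habs := abs_nonneg (x (Fin.last n))
      have hsq : x (Fin.last n) ^ 2 ≤ |x (Fin.last n)| := by
        rw [← sq_abs]; nlinarith
      rw [hx3]
      nlinarith

lemma IsGlobalSolution.neg_abs_mul_le {q : MvPolynomial (Fin (n + 1)) ℝ}
    (hu : IsGlobalSolution n (fun _ => 0) u) (hqPo : MemPo n q)
    (hdecay : VanishAtInfty (n + 1) (fun x => u x + |x (Fin.last n)| * pev q x))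
    (x : EuclideanSpace ℝ (Fin (n + 1))) : -(|x (Fin.last n)| * pev q x) ≤ u x := by
  have hsmooth : ContDiff ℝ 2 fun x : EuclideanSpace ℝ (Fin (n + 1)) =>
      -1 * (x (Fin.last n) * pev q x) :=
    contDiff_const.mul (ContDiff.mul (by fun_prop) (contDiff_pev q))
  have upper : ∀ x : EuclideanSpace ℝ (Fin (n + 1)), 0 ≤ x (Fin.last n) →
      -(x (Fin.last n) * pev q x) ≤ u x := by
    intro x hx
    refine le_of_forall_pos_le_add fun ε hε => ?_
    obtain ⟨R, hR⟩ := hdecay ε hε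
    set ρ := max R ‖x‖
    have key := sub_le_of_superMeanVal
      (K := closedBall 0 ρ ∩ {y : EuclideanSpace ℝ (Fin (n + 1)) | 0 ≤ y (Fin.last n)})
      (V := ball 0 ρ ∩ {y : EuclideanSpace ℝ (Fin (n + 1)) | 0 < y (Fin.last n)})
      (M := ε)
      ((isCompact_closedBall 0 ρ).inter_right (isClosed_le continuous_const (by fun_prop)))
      (isOpen_ball.inter (isOpen_lt continuous_const (by fun_prop)))
      (inter_subset_inter ball_subset_closedBall fun y (hy : 0 < y (Fin.last n)) => hy.le)
      hu.1 hu.2.2.2.2 hsmooth.continuous.continuousOn (fun y _ => hsmooth.contDiffAt)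
      (fun y _ => by rw [lapl_const_mul, hqPo.2.1.2 y trivial, mul_zero]) ?_ x
      ⟨by simp [ρ], hx⟩
    · linarith
    · rintro y ⟨⟨hy1, hy2⟩, hy3⟩
      have hy2 : 0 ≤ y (Fin.last n) := hy2
      rcases hy2.eq_or_lt with h0 | h0
      · rw [← h0]
        have := hu.nonneg h0.symm
        linarith
      · have hyρ : R ≤ ‖y‖ := by
          refine (le_max_left R ‖x‖).trans (not_lt.1 fun hlt => hy3 ⟨?_, h0⟩)
          exact mem_ball_zero_iff.2 hlt
        have := (abs_lt.1 (hR y hyρ)).1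
        simp only [abs_of_pos h0] at this
        linarith
  rcases le_total 0 (x (Fin.last n)) with h0 | h0
  · rw [abs_of_nonneg h0]; exact upper x h0
  · have := upper (thinEmbed n (thinProj n x) (-x (Fin.last n))) (by simpa using h0)
    rw [← hu.2.1, ← hqPo.1, thinEmbed_thinProj, thinEmbed_last] at this
    rwa [abs_of_nonpos h0]

lemma IsGlobalSolution.pos_zero {q : MvPolynomial (Fin (n + 1)) ℝ}
    (hu : IsGlobalSolution n (fun _ => 0) u) (hq0 : pev q 0 < 0)
    (hle : ∀ x : EuclideanSpace ℝ (Fin (n + 1)), -(|x (Fin.last n)| * pev q x) ≤ u x) :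
    0 < u 0 := by
  refine (hu.nonneg (x := 0) (by simp)).lt_of_ne' fun h0 => ?_
  have hfreq := exists_gt_of_lapl_pos (x := 0) (h := fun y => (y (Fin.last n) - 0) ^ 2)
    hu.1 hu.2.2.2.2 (ContDiff.contDiffAt (by fun_prop)) (by rw [lapl_coord_sub_sq]; norm_num)
  refine hfreq ?_
  have hev : ∀ᶠ x : EuclideanSpace ℝ (Fin (n + 1)) in nhds 0,
      |x (Fin.last n)| < -pev q x := by
    refine ContinuousAt.eventually_lt ?_ ?_ (by simpa using hq0)
    · exact Continuous.continuousAt (by fun_prop)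
    · exact (contDiff_pev q).continuous.neg.continuousAt
  filter_upwards [hev] with x hx
  have h1 := hle x
  have h2 := sq_abs (x (Fin.last n))
  have h3 := abs_nonneg (x (Fin.last n))
  simp only [h0, PiLp.zero_apply, not_lt, sub_zero]
  nlinarith

lemma IsGlobalSolution.le_of_dilation {qh : MvPolynomial (Fin (n + 1)) ℝ}
    (hqh : qh.IsHomogeneous m) (hu : IsGlobalSolution n (fun _ => 0) u)
    (hdecay : VanishAtInfty (n + 1) (fun x => u x + |x (Fin.last n)| * pev (qh - 1) x))
    {c : ℝ} (hc : 1 ≤ c) (x : EuclideanSpace ℝ (Fin (n + 1))) :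
    (c ^ (m + 1))⁻¹ * u (c • x) ≤ u x := by
  have hc0 : 0 < c := by linarith
  set a := (c ^ (m + 1))⁻¹ with ha
  have hcm : 1 ≤ c ^ m := one_le_pow₀ hc
  have hcm1 : 1 ≤ c ^ (m + 1) := one_le_pow₀ hc
  have ha0 : 0 < a := by positivity
  have ha1 : a ≤ 1 := inv_le_one_of_one_le₀ hcm1
  have hac : a * c * c ^ m = 1 := by rw [ha, pow_succ]; field_simp
  have hac1 : a * c ≤ 1 := by nlinarith [mul_pos ha0 hc0]
  refine le_of_forall_pos_le_add fun ε hε => ?_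
  obtain ⟨R, hR⟩ := hdecay (ε / 2) (by positivity)
  set ρ := max R ‖x‖
  let V := ball 0 ρ \ ((fun y => c • y) ⁻¹' contactSet n (fun _ => 0) u)
  have hsm : ∀ y ∈ V, ContDiffAt ℝ 2 (fun y => a * u (c • y)) y := fun y hy =>
    contDiffAt_const.mul ((hu.contDiffAt hy.2).comp y (ContDiff.contDiffAt (by fun_prop)))
  have hcontu := hu.1
  have key := sub_le_of_superMeanVal (K := closedBall 0 ρ) (V := V) (M := ε)
    (isCompact_closedBall 0 ρ)
    (isOpen_ball.sdiff (hu.contactSet_isClosed.preimage (by fun_prop)))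
    (sdiff_subset.trans ball_subset_closedBall) hu.1 hu.2.2.2.2
    (Continuous.continuousOn (by fun_prop)) hsm
    (fun y hy => by
      rw [lapl_const_mul a (fun y => u (c • y)), lapl_comp_smul, hu.2.2.2.1.2 _ hy.2]; simp)
    ?_ x (by simp [ρ])
  · linarith
  · rintro y ⟨hy1, hy2⟩
    by_cases hyc : c • y ∈ contactSet n (fun _ => 0) u
    · have h1 : c * y (Fin.last n) = 0 := hyc.1
      have h2 : u (c • y) = 0 := hyc.2
      have := hu.nonneg ((mul_eq_zero.1 h1).resolve_left hc0.ne')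
      rw [h2]
      linarith
    · have hyρ : R ≤ ‖y‖ := by
        refine (le_max_left R ‖x‖).trans (not_lt.1 fun hlt => hy2 ⟨?_, hyc⟩)
        exact mem_ball_zero_iff.2 hlt
      have hcy : R ≤ ‖c • y‖ := by
        rw [norm_smul, Real.norm_of_nonneg hc0.le]
        nlinarith [norm_nonneg y]
      have h1 := (abs_lt.1 (hR y hyρ)).1
      have h2 := (abs_lt.1 (hR _ hcy)).2
      simp only [pev_sub_one, pev_smul hqh, PiLp.smul_apply, smul_eq_mul, abs_mul,
        abs_of_pos hc0] at h1 h2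
      have h3 := mul_le_mul_of_nonneg_left h2.le ha0.le
      have h4 : a * (c * |y (Fin.last n)| * (c ^ m * pev qh y - 1)) =
          |y (Fin.last n)| * pev qh y - a * c * |y (Fin.last n)| := by
        linear_combination |y (Fin.last n)| * pev qh y * hac
      have h5 : a * c * |y (Fin.last n)| ≤ |y (Fin.last n)| :=
        mul_le_of_le_one_left (abs_nonneg _) hac1
      have h6 : a * (ε / 2) ≤ ε / 2 := mul_le_of_le_one_left (by positivity) ha1
      rw [mul_add, h4] at h3
      linarith

end ThinSpace

/-- if `q = q^h - 1 ∈ 𝒫ᵒ_{n+1}` with `q^h` homogeneous of degree `m ≥ 2`,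
the corresponding global solution has bounded, star-shaped positivity set. -/
theorem statement4 (n m : ℕ) (hn : 2 ≤ n) (hm : 2 ≤ m)
    (qh q : MvPolynomial (Fin (n + 1)) ℝ)
    (hqh : qh.IsHomogeneous m) (hq : q = qh - 1) (hqPo : MemPo n q)
    (u : EuclideanSpace ℝ (Fin (n + 1)) → ℝ)
    (hu : IsGlobalSolution n (fun _ => 0) u)
    (hdecay : VanishAtInfty (n + 1) (fun x => u x + |x (Fin.last n)| * pev q x)) :
    Bornology.IsBounded {x' : EuclideanSpace ℝ (Fin n) | 0 < u (thinEmbed n x' 0)} ∧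
    ∀ x' ∈ {y' : EuclideanSpace ℝ (Fin n) | 0 < u (thinEmbed n y' 0)},
      ∀ t ∈ Set.Icc (0 : ℝ) 1,
        t • x' ∈ {y' : EuclideanSpace ℝ (Fin n) | 0 < u (thinEmbed n y' 0)} := by
  subst hq
  have hm0 : m ≠ 0 := by lia
  have hpos0 : 0 < u 0 := hu.pos_zero
    (by simp [pev_sub_one, pev_zero_of_homogeneous hqh hm0])
    (hu.neg_abs_mul_le hqPo hdecay)
  refine ⟨hu.isBounded_positivitySet (exists_le_pev_near_thin hqh hm0 hqPo.2.2) hdecay,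
    fun x' hx' t ht => ?_⟩
  simp only [mem_ofPred_eq] at hx' ⊢
  have hsmul : thinEmbed n (t • x') 0 = t • thinEmbed n x' 0 := by simp [smul_thinEmbed]
  rw [hsmul]
  rcases ht.1.eq_or_lt with rfl | ht0
  · simpa using hpos0
  · have hle := hu.le_of_dilation hqh hdecay (one_le_inv_iff₀.2 ⟨ht0, ht.2⟩) (t • thinEmbed n x' 0)
    rw [inv_smul_smul₀ ht0.ne'] at hle
    exact lt_of_lt_of_le (by positivity) hle

end
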